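/- arXiv:2208.06941 — 2 statements merged into one kernel-verified Lean document; each statement's English description precedes it below -/
import Mathlib

section
/- Let A, B : ℝ → ℂ^{N×N} be continuous and let s ≤ t. For each u ∈ [s, t] let V_A(t, u) and V_B(u, s) denote the fundamental solutions, i.e., for fixed u, the function v ↦ V_A(v, u) satisfies (d/dv) V_A(v, u) = A(v) V_A(v, u) with V_A(u, u) = I, and likewise for V_B with coefficient B. Then the Duhamel identity holds: V_A(t, s) − V_B(t, s) = ∫_s^t V_A(t, u) (A(u) − B(u)) V_B(u, s) du. -/
/-- The `N × N` complex matrices, realized as continuous linear operators on `ℂ^N`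
(Euclidean space), so that the operator norm is the spectral norm. -/
abbrev SpectralOp (N : ℕ) := EuclideanSpace ℂ (Fin N) →L[ℂ] EuclideanSpace ℂ (Fin N)

open Set

section LinearODE

variable {R : Type*} [NormedRing R] [NormedAlgebra ℝ R]

/-- Solutions of `Y' = A Y` with continuous coefficient are determined by one value. -/
theorem eq_of_hasDerivAt_mul_left {A Y Z : ℝ → R} (hA : Continuous A)
    (hY : ∀ v, HasDerivAt Y (A v * Y v) v) (hZ : ∀ v, HasDerivAt Z (A v * Z v) v)
    {u : ℝ} (hu : Y u = Z u) : Y = Z := by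
  ext t
  obtain ⟨a, b, ht, hu'⟩ : ∃ a b, t ∈ Ioo a b ∧ u ∈ Ioo a b :=
    ⟨min t u - 1, max t u + 1, by grind, by grind⟩
  obtain ⟨C, hC⟩ := isCompact_Icc.exists_bound_of_continuousOn (s := Icc a b) hA.continuousOn
  refine ODE_solution_unique_of_mem_Ioo (v := fun v y => A v * y) (K := C.toNNReal)
    (s := fun _ => univ) (fun v hv => ?_) hu' (fun v _ => ⟨hY v, trivial⟩)
    (fun v _ => ⟨hZ v, trivial⟩) hu ht
  refine LipschitzOnWith.of_dist_le_mul fun x _ y _ => ?_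
  rw [dist_eq_norm, dist_eq_norm, ← mul_sub]
  refine (norm_mul_le _ _).trans ?_
  gcongr
  exact (hC v (Ioo_subset_Icc_self hv)).trans (Real.le_coe_toNNReal C)

/-- The cocycle property of a fundamental solution. -/
theorem fundamentalSolution_mul {A : ℝ → R} (hA : Continuous A) {V : ℝ → ℝ → R}
    (hV0 : ∀ u, V u u = 1) (hV : ∀ u v, HasDerivAt (fun w => V w u) (A v * V v u) v)
    (t u s : ℝ) : V t u * V u s = V t s := by
  have h := eq_of_hasDerivAt_mul_left (Y := fun v => V v u * V u s) (u := u) hA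
    (fun v => by simpa only [mul_assoc] using (hV u v).mul_const (V u s)) (hV s) (by simp [hV0])
  exact congrFun h t

variable [CompleteSpace R]

theorem HasDerivAt.of_mul_eq_one {f g : ℝ → R} {f' : R} {x : ℝ} (hf : HasDerivAt f f' x)
    (hfg : ∀ y, f y * g y = 1) (hgf : ∀ y, g y * f y = 1) :
    HasDerivAt g (-(g x * f' * g x)) x := by
  have hg : g = fun y => Ring.inverse (f y) :=
    funext fun y => (Ring.inverse_unit ⟨f y, g y, hfg y, hgf y⟩).symm
  have h := (hasFDerivAt_ringInverse (𝕜 := ℝ) (⟨f x, g x, hfg x, hgf x⟩ : Rˣ)).comp_hasDerivAt x hf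
  have hgx : Ring.inverse (f x) = g x := (congrFun hg x).symm
  rw [hg]
  simpa [hgx] using! h

/-- The backward equation for a fundamental solution. -/
theorem hasDerivAt_fundamentalSolution_right {A : ℝ → R} (hA : Continuous A) {V : ℝ → ℝ → R}
    (hV0 : ∀ u, V u u = 1) (hV : ∀ u v, HasDerivAt (fun w => V w u) (A v * V v u) v)
    (t u : ℝ) : HasDerivAt (fun w => V t w) (-(V t u * A u)) u := by
  have hinv : ∀ v w, V v w * V w v = 1 := fun v w => by
    rw [fundamentalSolution_mul hA hV0 hV, hV0]
  have h := (hV t u).of_mul_eq_one (g := fun w => V t w) (fun w => hinv w t) (fun w => hinv t w)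
  simpa only [mul_assoc, hinv, mul_one] using h

/-- Duhamel's identity in a real Banach algebra. -/
theorem fundamentalSolution_sub_eq_integral {A B : ℝ → R} (hA : Continuous A) (hB : Continuous B)
    {V W : ℝ → ℝ → R}
    (hV0 : ∀ u, V u u = 1) (hV : ∀ u v, HasDerivAt (fun w => V w u) (A v * V v u) v)
    (hW0 : ∀ u, W u u = 1) (hW : ∀ u v, HasDerivAt (fun w => W w u) (B v * W v u) v)
    (s t : ℝ) : V t s - W t s = ∫ u in s..t, V t u * (A u - B u) * W u s := by
  have hV' := hasDerivAt_fundamentalSolution_right hA hV0 hV t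
  have hderiv : ∀ u ∈ uIcc s t,
      HasDerivAt (fun w => -(V t w * W w s)) (V t u * (A u - B u) * W u s) u := fun u _ => by
    convert! ((hV' u).mul (hW s u)).neg using 1
    noncomm_ring
  have hVc : Continuous fun w => V t w :=
    continuous_iff_continuousAt.2 fun u => (hV' u).continuousAt
  have hWc : Continuous fun w => W w s :=
    continuous_iff_continuousAt.2 fun u => (hW s u).continuousAt
  rw [intervalIntegral.integral_eq_sub_of_hasDerivAt hderiv
    (((hVc.mul (hA.sub hB)).mul hWc).intervalIntegrable s t)]
  simp only [hV0, hW0, one_mul, mul_one]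
  abel

end LinearODE

/-- **Duhamel identity.** Let `A, B : ℝ → ℂ^{N×N}` be continuous, `s ≤ t`,
and let `VA v u`, `VB v u` denote the fundamental solutions (time-ordered exponentials):
for each fixed `u`, `v ↦ VA v u` solves `d/dv VA(v,u) = A(v) VA(v,u)` with `VA(u,u) = I`,
and likewise for `VB` with coefficient `B`.  Then
`VA(t,s) − VB(t,s) = ∫_s^t VA(t,u) (A(u) − B(u)) VB(u,s) du`. -/
theorem stmt_4 {N : ℕ} (A B : ℝ → SpectralOp N)
    (hA : Continuous A) (hB : Continuous B) (s t : ℝ) (hst : s ≤ t)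
    (VA VB : ℝ → ℝ → SpectralOp N)
    (hVA0 : ∀ u, VA u u = 1)
    (hVA : ∀ u v, HasDerivAt (fun w => VA w u) (A v * VA v u) v)
    (hVB0 : ∀ u, VB u u = 1)
    (hVB : ∀ u v, HasDerivAt (fun w => VB w u) (B v * VB v u) v) :
    VA t s - VB t s = ∫ u in s..t, VA t u * (A u - B u) * VB u s := by
  let _ : NormedAlgebra ℝ (SpectralOp N) :=
    { Algebra.ofModule (R := ℝ) (A := SpectralOp N) smul_mul_assoc mul_smul_comm with
      norm_smul_le := norm_smul_le }
  exact fundamentalSolution_sub_eq_integral hA hB hVA0 hVA hVB0 hVB s t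
end

section
/- Let A, B : ℝ → ℂ^{N×N} be continuous and let s ≤ t. Let V_A(t, s) and V_B(t, s) denote the fundamental solutions with coefficients A and B respectively. Then ‖V_A(t, s) − V_B(t, s)‖ ≤ exp( (t − s) · max_{u ∈ [s, t]} max(‖A(u)‖, ‖B(u)‖) ) · ∫_s^t ‖B(u) − A(u)‖ du. -/
open Set in
/-- A Grönwall inequality whose inhomogeneity already grows like `exp (K * (u - s))`. -/
theorem norm_le_exp_mul_add_integral_of_norm_deriv_le {E : Type*} [NormedAddCommGroup E]
    [NormedSpace ℝ E] {f f' : ℝ → E} {g : ℝ → ℝ} {K s t : ℝ} (hst : s ≤ t)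
    (hf : ∀ u, HasDerivAt f (f' u) u) (hg : Continuous g)
    (bound : ∀ u ∈ Ico s t, ‖f' u‖ ≤ K * ‖f u‖ + Real.exp (K * (u - s)) * g u) :
    ‖f t‖ ≤ Real.exp (K * (t - s)) * (‖f s‖ + ∫ u in s..t, g u) := by
  have key : ∀ ε > 0, ‖f t‖ ≤
      Real.exp (K * (t - s)) * (‖f s‖ + (∫ u in s..t, g u) + ε * (t - s)) := by
    intro ε hε
    have hφ : ∀ x, HasDerivAt
        (fun x => Real.exp (K * (x - s)) * (‖f s‖ + (∫ u in s..x, g u) + ε * (x - s)))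
        (K * (Real.exp (K * (x - s)) * (‖f s‖ + (∫ u in s..x, g u) + ε * (x - s))) +
          Real.exp (K * (x - s)) * (g x + ε)) x := by
      intro x
      have hexp := (((hasDerivAt_id x).sub_const s).const_mul K).exp
      have hint := ((hg.integral_hasStrictDerivAt s x).hasDerivAt.const_add ‖f s‖).add
        (((hasDerivAt_id x).sub_const s).const_mul ε)
      refine (hexp.mul hint).congr_deriv ?_
      simp only [Pi.add_apply, id_eq]
      ring
    refine image_norm_le_of_norm_deriv_right_lt_deriv_boundary
      (fun x _ => (hf x).continuousAt.continuousWithinAt)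
      (fun x _ => (hf x).hasDerivWithinAt) (by simp) hφ ?_ (right_mem_Icc.2 hst)
    intro x hx hfx
    have hx' := bound x hx
    rw [hfx] at hx'
    have : 0 < Real.exp (K * (x - s)) * ε := by positivity
    linarith
  have hlim : Filter.Tendsto
      (fun ε => Real.exp (K * (t - s)) * (‖f s‖ + (∫ u in s..t, g u) + ε * (t - s)))
      (nhdsWithin 0 (Ioi 0)) (nhds (Real.exp (K * (t - s)) * (‖f s‖ + ∫ u in s..t, g u))) := by
    have hc : Continuous
        fun ε => Real.exp (K * (t - s)) * (‖f s‖ + (∫ u in s..t, g u) + ε * (t - s)) := by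
      fun_prop
    simpa using (hc.tendsto 0).mono_left nhdsWithin_le_nhds
  exact ge_of_tendsto hlim (by filter_upwards [self_mem_nhdsWithin] with ε hε using key ε hε)

/-- Let `A, B : ℝ → ℂ^{N×N}` be continuous, `s ≤ t`, and let
`VA`, `VB` be the fundamental solutions with coefficients `A`, `B` (started at `s`).  Then
`‖VA(t,s) − VB(t,s)‖ ≤ exp((t−s)·max_{u∈[s,t]} max(‖A u‖, ‖B u‖)) · ∫_s^t ‖B(u) − A(u)‖ du`. -/
theorem stmt_5 {N : ℕ} (A B : ℝ → SpectralOp N)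
    (hA : Continuous A) (hB : Continuous B) (s t : ℝ) (hst : s ≤ t)
    (VA VB : ℝ → SpectralOp N)
    (hVA0 : VA s = 1) (hVA : ∀ u, HasDerivAt VA (A u * VA u) u)
    (hVB0 : VB s = 1) (hVB : ∀ u, HasDerivAt VB (B u * VB u) u) :
    ‖VA t - VB t‖ ≤
      Real.exp ((t - s) * ⨆ u : Set.Icc s t, max ‖A ↑u‖ ‖B ↑u‖) *
        ∫ u in s..t, ‖B u - A u‖ := by
  set K := ⨆ u : Set.Icc s t, max ‖A ↑u‖ ‖B ↑u‖
  have hbdd : BddAbove (Set.range fun u : Set.Icc s t => max ‖A ↑u‖ ‖B ↑u‖) :=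
    (isCompact_range (by fun_prop)).bddAbove
  have hle : ∀ u ∈ Set.Icc s t, max ‖A u‖ ‖B u‖ ≤ K := fun u hu => le_ciSup hbdd ⟨u, hu⟩
  have hVB_le : ∀ u ∈ Set.Icc s t, ‖VB u‖ ≤ Real.exp (K * (u - s)) := by
    intro u hu
    have h := norm_le_exp_mul_add_integral_of_norm_deriv_le (g := 0) (K := K) hu.1 hVB
      continuous_const (fun v hv => by
        have hB_le := (le_max_right _ _).trans (hle v ⟨hv.1, hv.2.le.trans hu.2⟩)
        simpa using (norm_mul_le (B v) (VB v)).trans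
          (mul_le_mul_of_nonneg_right hB_le (norm_nonneg _)))
    have h_one : ‖VB s‖ ≤ 1 := hVB0 ▸ ContinuousLinearMap.norm_id_le
    simp only [Pi.zero_apply, intervalIntegral.integral_zero, add_zero] at h
    exact h.trans (mul_le_of_le_one_right (Real.exp_pos _).le h_one)
  have h := norm_le_exp_mul_add_integral_of_norm_deriv_le (f := fun u => VA u - VB u)
    (g := fun u => ‖B u - A u‖) (K := K) hst (fun u => (hVA u).sub (hVB u)) (by fun_prop) ?_
  · simpa [hVA0, hVB0, mul_comm K] using h
  intro u hu
  have hu' := Set.Ico_subset_Icc_self hu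
  have hA_le := (le_max_left _ _).trans (hle u hu')
  calc ‖A u * VA u - B u * VB u‖
      = ‖A u * (VA u - VB u) + (A u - B u) * VB u‖ := by rw [mul_sub, sub_mul, sub_add_sub_cancel]
    _ ≤ ‖A u‖ * ‖VA u - VB u‖ + ‖A u - B u‖ * ‖VB u‖ :=
        (norm_add_le _ _).trans (add_le_add (norm_mul_le _ _) (norm_mul_le _ _))
    _ ≤ K * ‖VA u - VB u‖ + Real.exp (K * (u - s)) * ‖B u - A u‖ := by
        rw [norm_sub_rev (A u), mul_comm ‖B u - A u‖]
        gcongr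
        exact hVB_le u hu'
end
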